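/- There exists ε₀ > 0, depending only on n, σ₀, A₀ and A₁, such that for every ε ∈ (0, ε₀) the following holds. Define z(t,x,ξ) = x(t,x,ξ) − x − 2t ξ(t,x,ξ) and ζ(t,x,ξ) = ξ(t,x,ξ) − ξ. For every (x,ξ) ∈ 𝒮₊ (resp. (x,ξ) ∈ 𝒮₋) with 1/2 ≤ |ξ| ≤ 2 and every t ≥ 0 (resp. t ≤ 0): |z_j(t,x,ξ)| ≤ (2·10²/σ₀) ε max(A₀,A₁) and |ζ_j(t,x,ξ)| ≤ (2·10²/σ₀) ε max(A₀,A₁) for every j = 1,…,n, and moreover 1/3 ≤ (1 + |x(t,x,ξ)|²)/(1 + |x|² + t²) ≤ 40. -/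

import Mathlib

open MeasureTheory Set
open scoped BigOperators

noncomputable section

namespace Paper

/-- `ℝⁿ` with the Euclidean norm. -/
abbrev Eu (n : ℕ) := EuclideanSpace ℝ (Fin n)

/-- The Japanese bracket `⟨x⟩ = (1 + |x|²)^{1/2}`. -/
def jb {n : ℕ} (x : Eu n) : ℝ := Real.sqrt (1 + ‖x‖ ^ 2)

/-- `⟨t⟩ = (1 + t²)^{1/2}` for a real number `t`. -/
def jbr (t : ℝ) : ℝ := Real.sqrt (1 + t ^ 2)

/-- The dot product `x·ξ` on `ℝⁿ`. -/
def dotp {n : ℕ} (x ξ : Eu n) : ℝ := ∑ j, x j * ξ j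

/-- First-order partial derivative `∂/∂xᵢ`. -/
def pd {n : ℕ} (i : Fin n) (f : Eu n → ℝ) : Eu n → ℝ :=
  fun x => fderiv ℝ f x (EuclideanSpace.single i 1)

/-- The list of coordinate directions attached to a multi-index `γ`. -/
def mIdx {n : ℕ} (γ : Fin n → ℕ) : List (Fin n) :=
  (List.finRange n).foldr (fun i acc => List.replicate (γ i) i ++ acc) []

/-- The multi-index partial derivative `∂^γ` of a function on `ℝⁿ`. -/
def mderiv {n : ℕ} (γ : Fin n → ℕ) (f : Eu n → ℝ) : Eu n → ℝ :=
  (mIdx γ).foldr pd f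

/-- The order `|γ|` of a multi-index. -/
def mOrd {n : ℕ} (γ : Fin n → ℕ) : ℕ := ∑ i, γ i

/-- Partial derivative in the first group of variables of a function `f(x,ξ)`. -/
def pdX {n : ℕ} (i : Fin n) (f : Eu n → Eu n → ℝ) : Eu n → Eu n → ℝ :=
  fun x ξ => fderiv ℝ (fun y => f y ξ) x (EuclideanSpace.single i 1)

/-- Partial derivative in the second group of variables of a function `f(x,ξ)`. -/
def pdXi {n : ℕ} (i : Fin n) (f : Eu n → Eu n → ℝ) : Eu n → Eu n → ℝ :=
  fun x ξ => fderiv ℝ (fun η => f x η) ξ (EuclideanSpace.single i 1)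

/-- The mixed multi-index derivative `∂_x^A ∂_ξ^B` of a function `f(x,ξ)`. -/
def mderiv2 {n : ℕ} (A B : Fin n → ℕ) (f : Eu n → Eu n → ℝ) : Eu n → Eu n → ℝ :=
  (mIdx A).foldr pdX ((mIdx B).foldr pdXi f)

section OutgoingCurves

variable {E : Type*} [NormedAddCommGroup E] [InnerProductSpace ℝ E]

/-- A continuous real function that starts below `a` and cannot reach `a` as long as it has
stayed at or below `a` remains at or below `a`. -/
theorem le_of_bootstrap {f : ℝ → ℝ} (hf : Continuous f) {a : ℝ} (h0 : f 0 < a)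
    (h : ∀ T, 0 ≤ T → (∀ s ∈ Icc 0 T, f s ≤ a) → f T < a) {t : ℝ} (ht : 0 ≤ t) : f t ≤ a := by
  by_contra! hlt
  have hK : IsCompact (Icc 0 t ∩ {s | a ≤ f s}) :=
    isCompact_Icc.inter_right (isClosed_le continuous_const hf)
  obtain ⟨τ, ⟨⟨hτ0, hτt⟩, hτa⟩, hmin⟩ := hK.exists_isLeast ⟨t, ⟨ht, le_rfl⟩, hlt.le⟩
  have hτa : a ≤ f τ := hτa
  obtain ⟨s, ⟨hs0, hsτ⟩, hsa⟩ := intermediate_value_Icc hτ0 hf.continuousOn ⟨h0.le, hτa⟩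
  have hτs : τ ≤ s := hmin ⟨⟨hs0, hsτ.trans hτt⟩, hsa.ge⟩
  have hfτ : f τ = a := by rw [← hsa, le_antisymm hsτ hτs]
  refine (h τ hτ0 fun r hr => ?_).ne hfτ
  by_contra! hra
  have : τ ≤ r := hmin ⟨⟨hr.1, hr.2.trans hτt⟩, hra.le⟩
  rw [← le_antisymm this hr.2] at hra
  exact hra.ne' hfτ

/-- A curve starting at `0` whose speed is at most `K (1 + s) ^ (-(1 + σ))` stays within `K / σ`
of the origin. -/
theorem norm_le_of_norm_deriv_le_rpow {f f' : ℝ → E} {K σ T : ℝ} (hσ : 0 < σ) (hK : 0 ≤ K)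
    (hT : 0 ≤ T) (h0 : f 0 = 0) (hf : ∀ s, HasDerivAt f (f' s) s)
    (hb : ∀ s ∈ Icc 0 T, ‖f' s‖ ≤ K * (1 + s) ^ (-(1 + σ))) : ‖f T‖ ≤ K / σ := by
  have hB : ∀ s : ℝ, 0 ≤ s → HasDerivAt (fun s : ℝ => K / σ * (1 - (1 + s) ^ (-σ)))
      (K * (1 + s) ^ (-(1 + σ))) s := by
    intro s hs
    have h1 : HasDerivAt (fun s : ℝ => 1 + s) 1 s := (hasDerivAt_id s).const_add 1
    have h2 := h1.rpow_const (p := -σ) (Or.inl (by positivity))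
    refine ((h2.const_sub 1).const_mul (K / σ)).congr_deriv ?_
    rw [show -σ - 1 = -(1 + σ) by ring]
    field_simp
  have key := image_norm_le_of_norm_deriv_right_le_deriv_boundary' (a := 0) (b := T)
    (fun s _ => (hf s).continuousAt.continuousWithinAt) (fun s _ => (hf s).hasDerivWithinAt)
    (B := fun s : ℝ => K / σ * (1 - (1 + s) ^ (-σ))) (by simp [h0])
    (fun s hs => (hB s hs.1).continuousAt.continuousWithinAt)
    (fun s hs => (hB s hs.1).hasDerivWithinAt) (fun s hs => hb s ⟨hs.1, hs.2.le⟩)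
    ⟨hT, le_rfl⟩
  refine key.trans (mul_le_of_le_one_right (by positivity) ?_)
  have : (0 : ℝ) ≤ (1 + T) ^ (-σ) := by positivity
  linarith

/-- A small perturbation of an outgoing straight line escapes to infinity at a linear rate. -/
theorem one_add_norm_sq_bounds_of_outgoing {x ξ y : E} {t : ℝ} (ht : 0 ≤ t) (hξ : 1 / 2 ≤ ‖ξ‖)
    (hξ' : ‖ξ‖ ≤ 2) (hout : -(1 / 4) * √(1 + ‖x‖ ^ 2) * ‖ξ‖ ≤ inner ℝ x ξ)
    (hy : ‖y - x - (2 * t) • ξ‖ ≤ t / 10) :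
    1 + ‖x‖ ^ 2 + t ^ 2 ≤ 3 * (1 + ‖y‖ ^ 2) ∧ 1 + ‖y‖ ^ 2 ≤ 40 * (1 + ‖x‖ ^ 2 + t ^ 2) := by
  set w := y - x - (2 * t) • ξ with hw
  set a := x + (2 * t) • ξ with ha
  set X := √(1 + ‖x‖ ^ 2) with hX
  have hX2 : X ^ 2 = 1 + ‖x‖ ^ 2 := Real.sq_sqrt (by positivity)
  have haw : y = a + w := by rw [hw, ha]; abel
  have hya : ‖y‖ ≤ ‖a‖ + ‖w‖ := haw ▸ norm_add_le a w
  have hay : ‖a‖ ≤ ‖y‖ + ‖w‖ := by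
    rw [show a = y - w by rw [haw]; abel]
    exact norm_sub_le y w
  have hasq : ‖a‖ ^ 2 = ‖x‖ ^ 2 + 4 * t * inner ℝ x ξ + 4 * t ^ 2 * ‖ξ‖ ^ 2 := by
    rw [ha, norm_add_sq_real, inner_smul_right, norm_smul, Real.norm_eq_abs, mul_pow, sq_abs]
    ring
  have hale : ‖a‖ ≤ ‖x‖ + 2 * t * ‖ξ‖ := by
    refine (norm_add_le _ _).trans_eq ?_
    rw [norm_smul, Real.norm_eq_abs, abs_of_nonneg (by positivity)]
  have hw2 : ‖w‖ ^ 2 ≤ t ^ 2 / 100 := by nlinarith [norm_nonneg w]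
  constructor
  · have h1 : ‖a‖ ^ 2 ≤ 4 / 3 * ‖y‖ ^ 2 + 4 * ‖w‖ ^ 2 := by
      have : ‖a‖ ^ 2 ≤ (‖y‖ + ‖w‖) ^ 2 := by gcongr
      nlinarith [sq_nonneg (‖y‖ - 3 * ‖w‖)]
    have h2 : X ^ 2 - X * (t * ‖ξ‖) + 4 * (t * ‖ξ‖) ^ 2 ≤ 1 + ‖a‖ ^ 2 := by
      nlinarith [mul_le_mul_of_nonneg_left hout (by positivity : 0 ≤ 4 * t)]
    have h3 : t ≤ 2 * (t * ‖ξ‖) := by nlinarith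
    have h4 : t ^ 2 ≤ 4 * (t * ‖ξ‖) ^ 2 := by nlinarith
    nlinarith [sq_nonneg (X - 2 * (t * ‖ξ‖)), sq_nonneg X]
  · have h1 : ‖y‖ ^ 2 ≤ 9 / 8 * ‖a‖ ^ 2 + 9 * ‖w‖ ^ 2 := by
      have : ‖y‖ ^ 2 ≤ (‖a‖ + ‖w‖) ^ 2 := by gcongr
      nlinarith [sq_nonneg (‖a‖ - 8 * ‖w‖)]
    have h2 : ‖a‖ ≤ ‖x‖ + 4 * t := by nlinarith
    have h3 : ‖a‖ ^ 2 ≤ (‖x‖ + 4 * t) ^ 2 := by gcongr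
    nlinarith [sq_nonneg (‖x‖ - 4 * t), sq_nonneg t, sq_nonneg ‖x‖]

theorem rpow_neg_one_add_le {y s σ : ℝ} (hσ : 0 < σ) (hσ' : σ < 1) (hs : 0 ≤ s) (hy : 0 < y)
    (h : 1 + s ^ 2 ≤ 3 * y ^ 2) : y ^ (-(1 + σ)) ≤ 6 * (1 + s) ^ (-(1 + σ)) := by
  have h6 : (0 : ℝ) < √6 := by positivity
  have h6' : √6 ^ 2 = 6 := Real.sq_sqrt (by norm_num)
  have h1 : (1 + s) / √6 ≤ y := by
    rw [div_le_iff₀ h6]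
    refine le_of_sq_le_sq ?_ (by positivity)
    rw [mul_pow, h6']
    nlinarith [sq_nonneg (1 - s)]
  have h16 : 1 ≤ √6 := Real.one_le_sqrt.2 (by norm_num)
  calc y ^ (-(1 + σ)) ≤ ((1 + s) / √6) ^ (-(1 + σ)) :=
        Real.rpow_le_rpow_of_nonpos (by positivity) h1 (by linarith)
    _ = √6 ^ (1 + σ) * (1 + s) ^ (-(1 + σ)) := by
        rw [Real.div_rpow (by positivity) h6.le, Real.rpow_neg h6.le (1 + σ)]
        field_simp
    _ ≤ 6 * (1 + s) ^ (-(1 + σ)) := by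
        gcongr
        calc √6 ^ (1 + σ) ≤ √6 ^ (2 : ℝ) :=
              Real.rpow_le_rpow_of_exponent_le h16 (by linarith)
          _ = 6 := by rw [Real.rpow_two, h6']

/-- Decay in time of powers of a quantity `y ≥ 1` growing at least linearly in time. -/
theorem rpow_neg_two_add_le {y s σ : ℝ} (hσ : 0 < σ) (hσ' : σ < 1) (hs : 0 ≤ s) (hy : 0 < y)
    (h : 1 + s ^ 2 ≤ 3 * y ^ 2) :
    y ^ (-(2 + σ)) ≤ 21 / 2 * (1 + s) ^ (-(1 + σ)) ∧
      s * y ^ (-(2 + σ)) ≤ 21 / 2 * (1 + s) ^ (-(1 + σ)) := by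
  have h1 := rpow_neg_one_add_le hσ hσ' hs hy h
  have h2 : y ^ (-(2 + σ)) = y ^ (-(1 + σ)) / y := by
    rw [show -(2 + σ) = -(1 + σ) - 1 by ring, Real.rpow_sub_one hy.ne']
  have h3 : 1 ≤ 7 / 4 * y := by nlinarith
  have h4 : s ≤ 7 / 4 * y := by
    refine le_of_sq_le_sq ?_ (by positivity)
    nlinarith
  have h5 : 0 ≤ y ^ (-(1 + σ)) := by positivity
  rw [h2, mul_div_assoc', div_le_iff₀ hy, div_le_iff₀ hy]
  constructor <;> nlinarith

/-- Bounds for the deviation from free motion of an outgoing curve of a decaying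
perturbation of the free Hamiltonian flow. -/
theorem outgoing_curve_bounds {X Ξ V W : ℝ → E} {x ξ : E} {σ c : ℝ} (hσ : 0 < σ) (hσ' : σ < 1)
    (hc : 0 < c) (hcσ : c ≤ σ / 4000) (hX : ∀ t, HasDerivAt X (V t) t)
    (hΞ : ∀ t, HasDerivAt Ξ (W t) t)
    (hV : ∀ t, ‖V t - (2 : ℝ) • Ξ t‖ ≤ 2 * c * √(1 + ‖X t‖ ^ 2) ^ (-(1 + σ)) * ‖Ξ t‖)
    (hW : ∀ t, ‖W t‖ ≤ c * √(1 + ‖X t‖ ^ 2) ^ (-(2 + σ)) * ‖Ξ t‖ ^ 2)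
    (hX0 : X 0 = x) (hΞ0 : Ξ 0 = ξ) (hξ : 1 / 2 ≤ ‖ξ‖) (hξ' : ‖ξ‖ ≤ 2)
    (hout : -(1 / 4) * √(1 + ‖x‖ ^ 2) * ‖ξ‖ ≤ inner ℝ x ξ) {t : ℝ} (ht : 0 ≤ t) :
    ‖X t - x - (2 * t) • Ξ t‖ ≤ 200 * c / σ ∧ ‖Ξ t - ξ‖ ≤ 200 * c / σ ∧
      1 + ‖x‖ ^ 2 + t ^ 2 ≤ 3 * (1 + ‖X t‖ ^ 2) ∧
      1 + ‖X t‖ ^ 2 ≤ 40 * (1 + ‖x‖ ^ 2 + t ^ 2) := by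
  have hΞnorm : ∀ s, ‖Ξ s - ξ‖ ≤ 1 / 40 → ‖Ξ s‖ ≤ 81 / 40 := fun s hs => by
    have : ‖Ξ s‖ ≤ ‖Ξ s - ξ‖ + ‖ξ‖ := by simpa using norm_add_le (Ξ s - ξ) ξ
    linarith
  have hXbounds : ∀ T, 0 ≤ T → (∀ s ∈ Icc 0 T, ‖Ξ s - ξ‖ ≤ 1 / 40) →
      1 + ‖x‖ ^ 2 + T ^ 2 ≤ 3 * (1 + ‖X T‖ ^ 2) ∧
        1 + ‖X T‖ ^ 2 ≤ 40 * (1 + ‖x‖ ^ 2 + T ^ 2) := by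
    intro T hT hs
    refine one_add_norm_sq_bounds_of_outgoing hT hξ hξ' hout ?_
    have hd : ∀ s, HasDerivAt (fun s => X s - x - (2 * s) • ξ) (V s - (2 : ℝ) • ξ) s := by
      intro s
      have h2 : HasDerivAt (fun s : ℝ => 2 * s) 2 s := by
        simpa using (hasDerivAt_id s).const_mul (2 : ℝ)
      exact ((hX s).sub_const x).sub (h2.smul_const ξ)
    have hb : ∀ s ∈ Icc 0 T, ‖V s - (2 : ℝ) • ξ‖ ≤ 1 / 10 := by
      intro s hs'
      have h1 : ‖V s - (2 : ℝ) • ξ‖ ≤ ‖V s - (2 : ℝ) • Ξ s‖ + 2 * ‖Ξ s - ξ‖ := by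
        have := norm_add_le (V s - (2 : ℝ) • Ξ s) ((2 : ℝ) • (Ξ s - ξ))
        rw [norm_smul, smul_sub] at this
        simpa using this
      have h2 : √(1 + ‖X s‖ ^ 2) ^ (-(1 + σ)) ≤ 1 :=
        Real.rpow_le_one_of_one_le_of_nonpos
          (Real.one_le_sqrt.2 (by nlinarith [sq_nonneg ‖X s‖])) (by linarith)
      have h3 : 2 * c * √(1 + ‖X s‖ ^ 2) ^ (-(1 + σ)) * ‖Ξ s‖ ≤ 2 * c * 1 * (81 / 40) := by
        gcongr
        exact hΞnorm s (hs s hs')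
      have := hV s
      have := hs s hs'
      linarith
    have := (convex_Icc (0 : ℝ) T).norm_image_sub_le_of_norm_hasDerivWithin_le
      (fun s _ => (hd s).hasDerivWithinAt) hb (left_mem_Icc.2 hT) (right_mem_Icc.2 hT)
    simp only [hX0, sub_self, mul_zero, zero_smul, sub_zero, Real.norm_eq_abs, abs_of_nonneg hT]
      at this
    linarith
  have hjb : ∀ s, 0 ≤ s → 1 + ‖x‖ ^ 2 + s ^ 2 ≤ 3 * (1 + ‖X s‖ ^ 2) →
      1 + s ^ 2 ≤ 3 * √(1 + ‖X s‖ ^ 2) ^ 2 := fun s hs h => by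
    rw [Real.sq_sqrt (by positivity)]
    nlinarith [sq_nonneg ‖x‖]
  have hζ : ∀ T, 0 ≤ T → (∀ s ∈ Icc 0 T, ‖Ξ s - ξ‖ ≤ 1 / 40) → ‖Ξ T - ξ‖ ≤ 44 * c / σ := by
    intro T hT hs
    refine norm_le_of_norm_deriv_le_rpow (f := fun s => Ξ s - ξ) hσ (by positivity) hT
      (by simp [hΞ0]) (fun s => (hΞ s).sub_const ξ) fun s hs' => ?_
    have hXs := (hXbounds s hs'.1 fun r hr => hs r ⟨hr.1, hr.2.trans hs'.2⟩).1
    have h1 := (rpow_neg_two_add_le hσ hσ' hs'.1 (by positivity) (hjb s hs'.1 hXs)).1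
    have h2 := hΞnorm s (hs s hs')
    have hp : 0 ≤ (1 + s) ^ (-(1 + σ)) := by have := hs'.1; positivity
    calc ‖W s‖ ≤ c * √(1 + ‖X s‖ ^ 2) ^ (-(2 + σ)) * ‖Ξ s‖ ^ 2 := hW s
      _ ≤ c * (21 / 2 * (1 + s) ^ (-(1 + σ))) * (81 / 40) ^ 2 := by gcongr
      _ ≤ 44 * c * (1 + s) ^ (-(1 + σ)) := by nlinarith [mul_nonneg hc.le hp]
  have hcσ' : c / σ ≤ 1 / 4000 := by rw [div_le_iff₀ hσ]; linarith
  have hsmall : ∀ s, 0 ≤ s → ‖Ξ s - ξ‖ ≤ 1 / 40 := fun s hs =>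
    le_of_bootstrap (f := fun s => ‖Ξ s - ξ‖)
      ((continuous_iff_continuousAt.2 fun s => (hΞ s).continuousAt).sub continuous_const).norm
      (by simp [hΞ0]) (fun T hT h => by
        have := hζ T hT h
        rw [mul_div_assoc] at this
        linarith) hs
  have hcpos : 0 ≤ c / σ := by positivity
  refine ⟨?_, ?_, hXbounds t ht fun s hs => hsmall s hs.1⟩
  · have hd : ∀ s, HasDerivAt (fun s => X s - x - (2 * s) • Ξ s)
        (V s - ((2 * s) • W s + (2 : ℝ) • Ξ s)) s := by
      intro s
      have h2 : HasDerivAt (fun s : ℝ => 2 * s) 2 s := by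
        simpa using (hasDerivAt_id s).const_mul (2 : ℝ)
      exact ((hX s).sub_const x).sub (h2.smul (hΞ s))
    refine norm_le_of_norm_deriv_le_rpow (f := fun s => X s - x - (2 * s) • Ξ s) hσ
      (by positivity) ht (by simp [hX0]) hd fun s hs => ?_
    have hs0 := hs.1
    have hXs := (hXbounds s hs.1 fun r hr => hsmall r hr.1).1
    have hdec := (rpow_neg_two_add_le hσ hσ' hs.1 (by positivity) (hjb s hs.1 hXs)).2
    have hdec' := rpow_neg_one_add_le hσ hσ' hs.1 (by positivity) (hjb s hs.1 hXs)
    have h2 := hΞnorm s (hsmall s hs.1)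
    have hp : 0 ≤ (1 + s) ^ (-(1 + σ)) := by positivity
    calc ‖V s - ((2 * s) • W s + (2 : ℝ) • Ξ s)‖
        = ‖(V s - (2 : ℝ) • Ξ s) - (2 * s) • W s‖ := by congr 1; abel
      _ ≤ ‖V s - (2 : ℝ) • Ξ s‖ + 2 * s * ‖W s‖ := by
        refine (norm_sub_le _ _).trans_eq ?_
        rw [norm_smul, Real.norm_eq_abs, abs_of_nonneg (by positivity)]
      _ ≤ 2 * c * √(1 + ‖X s‖ ^ 2) ^ (-(1 + σ)) * ‖Ξ s‖ +
          2 * s * (c * √(1 + ‖X s‖ ^ 2) ^ (-(2 + σ)) * ‖Ξ s‖ ^ 2) := by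
        gcongr
        exacts [hV s, hW s]
      _ = 2 * c * √(1 + ‖X s‖ ^ 2) ^ (-(1 + σ)) * ‖Ξ s‖ +
          2 * c * (s * √(1 + ‖X s‖ ^ 2) ^ (-(2 + σ))) * ‖Ξ s‖ ^ 2 := by ring
      _ ≤ 2 * c * (6 * (1 + s) ^ (-(1 + σ))) * (81 / 40) +
          2 * c * (21 / 2 * (1 + s) ^ (-(1 + σ))) * (81 / 40) ^ 2 := by gcongr
      _ ≤ 200 * c * (1 + s) ^ (-(1 + σ)) := by nlinarith [mul_nonneg hc.le hp]
  · have := hζ t ht fun s hs => hsmall s hs.1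
    rw [mul_div_assoc] at this ⊢
    linarith

end OutgoingCurves

section Symbol

variable {n : ℕ}

theorem mIdx_single (l : Fin n) : mIdx (Pi.single l 1) = [l] := by
  have key : ∀ L : List (Fin n), L.Nodup →
      L.foldr (fun i acc => List.replicate ((Pi.single l 1 : Fin n → ℕ) i) i ++ acc) [] =
        if l ∈ L then [l] else [] := by
    intro L
    induction L with
    | nil => simp
    | cons a L ih =>
      intro hL
      rw [List.nodup_cons] at hL
      rw [List.foldr_cons, ih hL.2]
      by_cases hal : a = l
      · subst hal
        simp [hL.1]
      · simp [hal, Ne.symm hal]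
  simpa [mIdx] using key _ (List.nodup_finRange n)

theorem mderiv_single (l : Fin n) (f : Eu n → ℝ) : mderiv (Pi.single l 1) f = pd l f := by
  simp [mderiv, mIdx_single]

theorem mderiv_zero (f : Eu n → ℝ) : mderiv 0 f = f := by
  have : mIdx (0 : Fin n → ℕ) = [] := by simp [mIdx]
  simp [mderiv, this]

theorem sum_single_le_sum_antidiagonalTuple {F : (Fin n → ℕ) → ℝ} (hF : ∀ γ, 0 ≤ F γ) :
    ∑ l, F (Pi.single l 1) ≤ ∑ γ ∈ Finset.Nat.antidiagonalTuple n 1, F γ := by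
  have hinj : Function.Injective fun l : Fin n => (Pi.single l 1 : Fin n → ℕ) := fun a b h => by
    by_contra hab
    have := congrFun h a
    simp [hab] at this
  rw [← Finset.sum_image (f := F) (g := fun l : Fin n => (Pi.single l 1 : Fin n → ℕ))
    hinj.injOn]
  refine Finset.sum_le_sum_of_subset_of_nonneg (fun γ hγ => ?_) fun γ _ _ => hF γ
  obtain ⟨l, -, rfl⟩ := Finset.mem_image.1 hγ
  simp [Finset.Nat.mem_antidiagonalTuple]

theorem norm_le_sum_abs (v : Eu n) : ‖v‖ ≤ ∑ j, |v j| := by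
  rw [EuclideanSpace.norm_eq]
  refine Real.sqrt_le_iff.2 ⟨by positivity, ?_⟩
  simpa using Finset.sum_sq_le_sq_sum_of_nonneg (s := Finset.univ) (f := fun j => |v j|)
    fun j _ => abs_nonneg _

theorem hasDerivAt_toLp {f : ℝ → Eu n} {v : Fin n → ℝ} {t : ℝ}
    (h : ∀ j, HasDerivAt (fun s => f s j) (v j) t) : HasDerivAt f (WithLp.toLp 2 v) t := by
  have := (PiLp.continuousLinearEquiv 2 ℝ (fun _ : Fin n => ℝ)).symm.hasFDerivAt.comp_hasDerivAt t
    (hasDerivAt_pi.2 h)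
  exact this

theorem hasFDerivAt_coord (j : Fin n) (ξ : Eu n) :
    HasFDerivAt (fun η : Eu n => η j) (EuclideanSpace.proj j : Eu n →L[ℝ] ℝ) ξ :=
  (EuclideanSpace.proj j : Eu n →L[ℝ] ℝ).hasFDerivAt

theorem fderiv_symbol_momentum (B : Fin n → Fin n → ℝ) (ε : ℝ) (ξ : Eu n) (l : Fin n) :
    fderiv ℝ (fun η : Eu n => ‖η‖ ^ 2 + ε * ∑ j, ∑ k, B j k * η j * η k) ξ
      (EuclideanSpace.single l 1) = 2 * ξ l + ε * ∑ k, (B l k + B k l) * ξ k := by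
  have h : HasFDerivAt (fun η : Eu n => ‖η‖ ^ 2 + ε * ∑ j, ∑ k, B j k * η j * η k) _ ξ :=
    (hasStrictFDerivAt_norm_sq ξ).hasFDerivAt.add
      ((HasFDerivAt.fun_sum fun j _ => HasFDerivAt.fun_sum fun k _ =>
        ((hasFDerivAt_coord j ξ).const_mul (B j k)).mul (hasFDerivAt_coord k ξ)).const_mul ε)
  rw [h.fderiv]
  simp [Finset.sum_add_distrib, add_mul, EuclideanSpace.inner_single_right]
  simp_rw [mul_comm (ξ _) (B l _)]
  ring

theorem fderiv_symbol_position {b : Fin n → Fin n → Eu n → ℝ}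
    (hb : ∀ j k, Differentiable ℝ (b j k)) (ε : ℝ) (x ξ : Eu n) (l : Fin n) :
    fderiv ℝ (fun y : Eu n => ‖ξ‖ ^ 2 + ε * ∑ j, ∑ k, b j k y * ξ j * ξ k) x
      (EuclideanSpace.single l 1) = ε * ∑ j, ∑ k, pd l (b j k) x * ξ j * ξ k := by
  have h : HasFDerivAt (fun y : Eu n => ‖ξ‖ ^ 2 + ε * ∑ j, ∑ k, b j k y * ξ j * ξ k) _ x :=
    (((HasFDerivAt.fun_sum fun j _ => HasFDerivAt.fun_sum fun k _ =>
        (((hb j k x).hasFDerivAt.mul_const (ξ j)).mul_const (ξ k))).const_mul ε)).const_add _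
  rw [h.fderiv]
  simp only [smul_apply, sum_apply, smul_eq_mul, pd]
  exact congrArg (ε * ·) (Finset.sum_congr rfl fun j _ => Finset.sum_congr rfl fun k _ => by ring)

theorem sum_abs_quadratic_le (B : Fin n → Fin n → ℝ) (ξ : Eu n) :
    |∑ j, ∑ k, B j k * ξ j * ξ k| ≤ (∑ j, ∑ k, |B j k|) * ‖ξ‖ ^ 2 := by
  rw [Finset.sum_mul]
  refine (Finset.abs_sum_le_sum_abs _ _).trans (Finset.sum_le_sum fun j _ => ?_)
  rw [Finset.sum_mul]
  refine (Finset.abs_sum_le_sum_abs _ _).trans (Finset.sum_le_sum fun k _ => ?_)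
  rw [abs_mul, abs_mul, mul_assoc, sq]
  have h1 : |ξ j| ≤ ‖ξ‖ := PiLp.norm_apply_le ξ j
  have h2 : |ξ k| ≤ ‖ξ‖ := PiLp.norm_apply_le ξ k
  gcongr

theorem sum_abs_linear_le (B : Fin n → Fin n → ℝ) (ξ : Eu n) :
    ∑ l, |∑ k, (B l k + B k l) * ξ k| ≤ 2 * (∑ j, ∑ k, |B j k|) * ‖ξ‖ := by
  calc ∑ l, |∑ k, (B l k + B k l) * ξ k| ≤ ∑ l, ∑ k, (|B l k| + |B k l|) * ‖ξ‖ := by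
        refine Finset.sum_le_sum fun l _ => (Finset.abs_sum_le_sum_abs _ _).trans
          (Finset.sum_le_sum fun k _ => ?_)
        rw [abs_mul]
        have h2 : |ξ k| ≤ ‖ξ‖ := PiLp.norm_apply_le ξ k
        gcongr
        exact abs_add_le _ _
    _ = 2 * (∑ j, ∑ k, |B j k|) * ‖ξ‖ := by
        simp_rw [← Finset.sum_mul, Finset.sum_add_distrib]
        rw [Finset.sum_comm (f := fun l k => |B k l|)]
        ring

theorem dotp_eq_inner (x ξ : Eu n) : dotp x ξ = inner ℝ x ξ := by
  simp [dotp, PiLp.inner_apply, mul_comm]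

/-- Deviation bounds for an outgoing bicharacteristic of a metric that is a small decaying
perturbation of the flat one. -/
theorem outgoing_bicharacteristic_bounds {b : Fin n → Fin n → Eu n → ℝ} {σ M ε : ℝ}
    (hσ : 0 < σ) (hσ' : σ < 1) (hM : 0 < M) (hε : 0 < ε) (hεM : ε * M ≤ σ / 4000)
    (hb0 : ∀ x, ∑ j, ∑ k, |b j k x| ≤ M * jb x ^ (-(1 + σ)))
    (hb1 : ∀ x, ∑ l, ∑ j, ∑ k, |pd l (b j k) x| ≤ M * jb x ^ (-(2 + σ)))
    {X Ξ : ℝ → Eu n} {x ξ : Eu n}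
    (hX : ∀ t j, HasDerivAt (fun s => X s j)
      (2 * Ξ t j + ε * ∑ k, (b j k (X t) + b k j (X t)) * Ξ t k) t)
    (hΞ : ∀ t l, HasDerivAt (fun s => Ξ s l)
      (-(ε * ∑ j, ∑ k, pd l (b j k) (X t) * Ξ t j * Ξ t k)) t)
    (hX0 : X 0 = x) (hΞ0 : Ξ 0 = ξ) (hξ : 1 / 2 ≤ ‖ξ‖) (hξ' : ‖ξ‖ ≤ 2)
    (hout : -(1 / 4) * jb x * ‖ξ‖ ≤ dotp x ξ) {t : ℝ} (ht : 0 ≤ t) :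
    (∀ j : Fin n, |X t j - x j - 2 * t * Ξ t j| ≤ 2 * 10 ^ 2 / σ * ε * M ∧
        |Ξ t j - ξ j| ≤ 2 * 10 ^ 2 / σ * ε * M) ∧
      1 / 3 ≤ (1 + ‖X t‖ ^ 2) / (1 + ‖x‖ ^ 2 + t ^ 2) ∧
      (1 + ‖X t‖ ^ 2) / (1 + ‖x‖ ^ 2 + t ^ 2) ≤ 40 := by
  rw [dotp_eq_inner] at hout
  set V : ℝ → Eu n := fun t => WithLp.toLp 2 fun j =>
    2 * Ξ t j + ε * ∑ k, (b j k (X t) + b k j (X t)) * Ξ t k with hVdef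
  set W : ℝ → Eu n := fun t => WithLp.toLp 2 fun l =>
    -(ε * ∑ j, ∑ k, pd l (b j k) (X t) * Ξ t j * Ξ t k) with hWdef
  have hV : ∀ t, ‖V t - (2 : ℝ) • Ξ t‖ ≤
      2 * (ε * M) * √(1 + ‖X t‖ ^ 2) ^ (-(1 + σ)) * ‖Ξ t‖ := fun t => by
    refine (norm_le_sum_abs _).trans ?_
    simp only [hVdef, PiLp.sub_apply, PiLp.smul_apply, smul_eq_mul, add_sub_cancel_left, abs_mul ε,
      abs_of_pos hε, ← Finset.mul_sum]
    calc ε * ∑ l, |∑ k, (b l k (X t) + b k l (X t)) * Ξ t k|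
        ≤ ε * (2 * (∑ j, ∑ k, |b j k (X t)|) * ‖Ξ t‖) := by
          gcongr
          exact sum_abs_linear_le (fun j k => b j k (X t)) (Ξ t)
      _ ≤ ε * (2 * (M * jb (X t) ^ (-(1 + σ))) * ‖Ξ t‖) := by
          gcongr
          exact hb0 (X t)
      _ = 2 * (ε * M) * √(1 + ‖X t‖ ^ 2) ^ (-(1 + σ)) * ‖Ξ t‖ := by
          rw [jb]
          ring
  have hW : ∀ t, ‖W t‖ ≤ ε * M * √(1 + ‖X t‖ ^ 2) ^ (-(2 + σ)) * ‖Ξ t‖ ^ 2 := fun t => by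
    refine (norm_le_sum_abs _).trans ?_
    simp only [hWdef, abs_neg, abs_mul ε, abs_of_pos hε, ← Finset.mul_sum]
    calc ε * ∑ l, |∑ j, ∑ k, pd l (b j k) (X t) * Ξ t j * Ξ t k|
        ≤ ε * ∑ l, (∑ j, ∑ k, |pd l (b j k) (X t)|) * ‖Ξ t‖ ^ 2 := by
          gcongr with l
          exact sum_abs_quadratic_le (fun j k => pd l (b j k) (X t)) (Ξ t)
      _ = ε * ((∑ l, ∑ j, ∑ k, |pd l (b j k) (X t)|) * ‖Ξ t‖ ^ 2) := by rw [Finset.sum_mul]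
      _ ≤ ε * (M * jb (X t) ^ (-(2 + σ)) * ‖Ξ t‖ ^ 2) := by
          gcongr
          exact hb1 (X t)
      _ = ε * M * √(1 + ‖X t‖ ^ 2) ^ (-(2 + σ)) * ‖Ξ t‖ ^ 2 := by
          rw [jb]
          ring
  obtain ⟨hz, hζ, hlow, hupp⟩ := outgoing_curve_bounds hσ hσ' (mul_pos hε hM) hεM
    (fun t => hasDerivAt_toLp (hX t)) (fun t => hasDerivAt_toLp (hΞ t)) hV hW
    hX0 hΞ0 hξ hξ' hout ht
  have hconst : 200 * (ε * M) / σ = 2 * 10 ^ 2 / σ * ε * M := by ring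
  rw [hconst] at hz hζ
  refine ⟨fun j => ⟨?_, ?_⟩, ?_, ?_⟩
  · simpa using (PiLp.norm_apply_le (X t - x - (2 * t) • Ξ t) j).trans hz
  · simpa using (PiLp.norm_apply_le (Ξ t - ξ) j).trans hζ
  · rw [le_div_iff₀ (by positivity)]
    linarith
  · rw [div_le_iff₀ (by positivity)]
    exact hupp

end Symbol

/-- **Proposition III.3.1.** There is `ε₀ > 0`, depending only on `n, σ₀, A₀, A₁`, such
that for `ε ∈ (0,ε₀)` and `z(t,x,ξ) = x(t,x,ξ) − x − 2t ξ(t,x,ξ)`,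
`ζ(t,x,ξ) = ξ(t,x,ξ) − ξ`: for `(x,ξ) ∈ 𝒮₊` (resp. `𝒮₋`) with `1/2 ≤ |ξ| ≤ 2` and
`t ≥ 0` (resp. `t ≤ 0`) one has `|z_j|, |ζ_j| ≤ (2·10²/σ₀) ε max(A₀,A₁)` and
`1/3 ≤ (1 + |x(t,x,ξ)|²)/(1 + |x|² + t²) ≤ 40`. -/
theorem statement5
    (n : ℕ) (hn : 1 ≤ n) (σ₀ : ℝ) (hσ₀ : 0 < σ₀) (hσ₀' : σ₀ < 1)
    (A₀ A₁ : ℝ) (hA₀ : 0 < A₀) (hA₁ : 0 < A₁) :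
    ∃ ε₀ : ℝ, 0 < ε₀ ∧
      ∀ A : ℕ → ℝ, A 0 = A₀ → A 1 = A₁ → (∀ ℓ, 0 < A ℓ) →
      ∀ b : Fin n → Fin n → Eu n → ℝ,
        (∀ j k, ContDiff ℝ (⊤ : ℕ∞) (b j k)) →
        (∀ (ℓ : ℕ) (x : Eu n),
          (∑ γ ∈ Finset.Nat.antidiagonalTuple n ℓ, ∑ j, ∑ k, |mderiv γ (b j k) x|) ≤
            A ℓ * jb x ^ (-(1 + (ℓ : ℝ) + σ₀))) →
      ∀ ε : ℝ, 0 < ε → ε < ε₀ → ε * A 0 ≤ 1 / 10 →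
      ∀ p : Eu n → Eu n → ℝ,
        (∀ x ξ, p x ξ = ‖ξ‖ ^ 2 + ε * ∑ j, ∑ k, b j k x * ξ j * ξ k) →
      ∀ Xf Ξf : ℝ → Eu n → Eu n → Eu n,
        ContDiff ℝ (⊤ : ℕ∞)
          (fun q : ℝ × Eu n × Eu n => (Xf q.1 q.2.1 q.2.2, Ξf q.1 q.2.1 q.2.2)) →
        (∀ (t : ℝ) (x ξ : Eu n) (j : Fin n),
          HasDerivAt (fun s => Xf s x ξ j)
            (fderiv ℝ (fun η => p (Xf t x ξ) η) (Ξf t x ξ)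
              (EuclideanSpace.single j 1)) t) →
        (∀ (t : ℝ) (x ξ : Eu n) (j : Fin n),
          HasDerivAt (fun s => Ξf s x ξ j)
            (-(fderiv ℝ (fun y => p y (Ξf t x ξ)) (Xf t x ξ)
              (EuclideanSpace.single j 1))) t) →
        (∀ x ξ, Xf 0 x ξ = x) → (∀ x ξ, Ξf 0 x ξ = ξ) →
      ∀ x ξ : Eu n, 1 / 2 ≤ ‖ξ‖ → ‖ξ‖ ≤ 2 →
        (∀ t : ℝ, 0 ≤ t → -(1 / 4) * jb x * ‖ξ‖ ≤ dotp x ξ →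
          (∀ j : Fin n,
            |Xf t x ξ j - x j - 2 * t * Ξf t x ξ j| ≤
                2 * 10 ^ 2 / σ₀ * ε * max A₀ A₁ ∧
              |Ξf t x ξ j - ξ j| ≤ 2 * 10 ^ 2 / σ₀ * ε * max A₀ A₁) ∧
            1 / 3 ≤ (1 + ‖Xf t x ξ‖ ^ 2) / (1 + ‖x‖ ^ 2 + t ^ 2) ∧
            (1 + ‖Xf t x ξ‖ ^ 2) / (1 + ‖x‖ ^ 2 + t ^ 2) ≤ 40) ∧
        (∀ t : ℝ, t ≤ 0 → dotp x ξ ≤ 1 / 4 * jb x * ‖ξ‖ →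
          (∀ j : Fin n,
            |Xf t x ξ j - x j - 2 * t * Ξf t x ξ j| ≤
                2 * 10 ^ 2 / σ₀ * ε * max A₀ A₁ ∧
              |Ξf t x ξ j - ξ j| ≤ 2 * 10 ^ 2 / σ₀ * ε * max A₀ A₁) ∧
            1 / 3 ≤ (1 + ‖Xf t x ξ‖ ^ 2) / (1 + ‖x‖ ^ 2 + t ^ 2) ∧
            (1 + ‖Xf t x ξ‖ ^ 2) / (1 + ‖x‖ ^ 2 + t ^ 2) ≤ 40) := by
  have hM : 0 < max A₀ A₁ := lt_max_of_lt_left hA₀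
  refine ⟨σ₀ / (4000 * max A₀ A₁), by positivity, ?_⟩
  rintro A rfl rfl - b hb hbA ε hε hεε - p hp Xf Ξf - hXf hΞf hX0 hΞ0 x ξ hξ hξ'
  obtain rfl : p = fun x ξ => ‖ξ‖ ^ 2 + ε * ∑ j, ∑ k, b j k x * ξ j * ξ k :=
    funext fun x => funext fun ξ => hp x ξ
  simp only [fderiv_symbol_momentum (fun j k => b j k _)] at hXf
  simp only [fderiv_symbol_position fun j k => (hb j k).differentiable (by simp)] at hΞf
  have hjb : ∀ (y : Eu n) (r : ℝ), 0 ≤ jb y ^ r := fun y r =>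
    Real.rpow_nonneg (Real.sqrt_nonneg _) r
  have hb0 : ∀ y, ∑ j, ∑ k, |b j k y| ≤ max (A 0) (A 1) * jb y ^ (-(1 + σ₀)) := fun y => by
    have h := hbA 0 y
    simp only [Finset.Nat.antidiagonalTuple_zero_right, Finset.sum_singleton, mderiv_zero,
      Nat.cast_zero, add_zero] at h
    exact h.trans (mul_le_mul_of_nonneg_right (le_max_left _ _) (hjb _ _))
  have hb1 : ∀ y, ∑ l, ∑ j, ∑ k, |pd l (b j k) y| ≤
      max (A 0) (A 1) * jb y ^ (-(2 + σ₀)) := fun y => by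
    have h := (sum_single_le_sum_antidiagonalTuple
      (F := fun γ => ∑ j, ∑ k, |mderiv γ (b j k) y|) fun γ => by positivity).trans (hbA 1 y)
    simp only [mderiv_single, Nat.cast_one, one_add_one_eq_two] at h
    exact h.trans (mul_le_mul_of_nonneg_right (le_max_right _ _) (hjb _ _))
  have hεM : ε * max (A 0) (A 1) ≤ σ₀ / 4000 := by
    rw [lt_div_iff₀ (by positivity)] at hεε
    linarith
  refine ⟨fun t ht hout => ?_, fun t ht hin => ?_⟩
  · exact outgoing_bicharacteristic_bounds hσ₀ hσ₀' hM hε hεM hb0 hb1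
      (fun t j => hXf t x ξ j) (fun t j => hΞf t x ξ j) (hX0 x ξ) (hΞ0 x ξ) hξ hξ' hout ht
  · have key := outgoing_bicharacteristic_bounds hσ₀ hσ₀' hM hε hεM hb0 hb1
      (X := fun s => Xf (-s) x ξ) (Ξ := fun s => -Ξf (-s) x ξ) (x := x) (ξ := -ξ)
      (fun t j => ?_) (fun t l => ?_) (by simp [hX0]) (by simp [hΞ0]) (by simpa using hξ)
      (by simpa using hξ') ?_ (t := -t) (by linarith)
    · simp only [neg_neg, PiLp.neg_apply, neg_sq] at key
      refine ⟨fun j => ?_, key.2⟩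
      have hj := key.1 j
      rw [neg_sub_neg, abs_sub_comm (ξ j)] at hj
      rwa [show 2 * -t * -(Ξf t x ξ).ofLp j = 2 * t * (Ξf t x ξ).ofLp j by ring] at hj
    · refine ((hXf (-t) x ξ j).scomp t (hasDerivAt_neg t)).congr_deriv ?_
      simp only [PiLp.neg_apply, mul_neg, Finset.sum_neg_distrib, smul_eq_mul]
      ring
    · refine ((hΞf (-t) x ξ l).scomp t (hasDerivAt_neg t)).neg.congr_deriv ?_
      simp
    · rw [dotp_eq_inner] at hin ⊢
      rw [inner_neg_right, norm_neg]
      linarith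

end Paper
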